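/- arXiv:2209.07390 — 6 statements merged into one kernel-verified Lean document; each statement's English description precedes it below -/
import Mathlib

section
/- Let v ∈ ℂ⁶ be such that the 2×3 matrix M(v) has rank 2 (equivalently, the point [v] ∈ ℙ⁵ does not lie on the threefold G³₃). If W₁ and W₂ are 2-dimensional ℂ-linear subspaces of ℂ⁶ such that v ∈ W₁ ∩ W₂ and each Wᵢ contains two linearly independent vectors of the form φ(x, y) (i.e., each Wᵢ is a secant line of R⁴ through [v]), then W₁ = W₂. (Uniqueness of the secant of R⁴ through a point off G³₃.) -/
/-- The parametrization of the affine cone over the degree-4 rational normal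
scroll `R⁴ ⊂ ℙ⁵`. -/
def phi (x y : Fin 2 → ℂ) : Fin 6 → ℂ :=
  ![x 0 * (y 0)^2, x 0 * (y 0) * (y 1), x 0 * (y 1)^2,
    x 1 * (y 0)^2, x 1 * (y 0) * (y 1), x 1 * (y 1)^2]

/-- The 2×3 matrix `M(v)` with rows `(v₀₀,v₀₁,v₀₂)` and `(v₁₀,v₁₁,v₁₂)`. -/
def Mmat (v : Fin 6 → ℂ) : Matrix (Fin 2) (Fin 3) ℂ :=
  Matrix.of ![![v 0, v 1, v 2], ![v 3, v 4, v 5]]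

/-- `W` is (the affine cone over) a secant line of `R⁴`: a 2-dimensional linear
subspace of `ℂ⁶` containing two linearly independent vectors of the form `φ(x,y)`. -/
def IsSecant (W : Submodule ℂ (Fin 6 → ℂ)) : Prop :=
  Module.finrank ℂ W = 2 ∧
    ∃ x y x' y' : Fin 2 → ℂ, phi x y ∈ W ∧ phi x' y' ∈ W ∧
      LinearIndependent ℂ ![phi x y, phi x' y']

theorem Mmat_minor_ne_zero {v : Fin 6 → ℂ} (hv : (Mmat v).rank = 2) :
    ¬(v 0 * v 4 - v 1 * v 3 = 0 ∧ v 0 * v 5 - v 2 * v 3 = 0 ∧ v 1 * v 5 - v 2 * v 4 = 0) := by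
  rintro ⟨h₀₁, h₀₂, h₁₂⟩
  have hli : LinearIndependent ℂ ![![v 0, v 1, v 2], ![v 3, v 4, v 5]] := by
    rw [linearIndependent_iff_card_eq_finrank_span]
    have h := (Mmat v).rank_eq_finrank_span_row
    rw [hv] at h
    exact (Fintype.card_fin 2).trans h
  rw [LinearIndependent.pair_iff] at hli
  have col : v 0 = 0 ∧ v 1 = 0 ∧ v 2 = 0 := by
    refine ⟨?_, ?_, ?_⟩
    · refine neg_eq_zero.mp (hli (v 3) (-v 0) ?_).2
      ext i
      fin_cases i <;> simp <;> grind
    · refine neg_eq_zero.mp (hli (v 4) (-v 1) ?_).2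
      ext i
      fin_cases i <;> simp <;> grind
    · refine neg_eq_zero.mp (hli (v 5) (-v 2) ?_).2
      ext i
      fin_cases i <;> simp <;> grind
  have := hli 1 0 (by simp [col])
  simp at this

/-- The minors of `Mmat` at a point of a secant line are, up to the factor `[x, x'] [y, y']`, the
coefficients of the binary quadric with zeros `y` and `y'`. -/
theorem minors_phi_add_phi (x y x' y' : Fin 2 → ℂ) {v : Fin 6 → ℂ}
    (h : v = phi x y + phi x' y') :
    v 0 * v 4 - v 1 * v 3 =
      (x 0 * x' 1 - x 1 * x' 0) * (y 0 * y' 1 - y 1 * y' 0) * (y 0 * y' 0) ∧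
    v 0 * v 5 - v 2 * v 3 =
      (x 0 * x' 1 - x 1 * x' 0) * (y 0 * y' 1 - y 1 * y' 0) * (y 0 * y' 1 + y 1 * y' 0) ∧
    v 1 * v 5 - v 2 * v 4 =
      (x 0 * x' 1 - x 1 * x' 0) * (y 0 * y' 1 - y 1 * y' 0) * (y 1 * y' 1) := by
  subst h
  refine ⟨?_, ?_, ?_⟩ <;> simp [phi] <;> ring

theorem exists_eq_smul_of_bracket_eq_zero {y q : Fin 2 → ℂ} (hy : y ≠ 0)
    (h : y 0 * q 1 - y 1 * q 0 = 0) : ∃ t : ℂ, q = t • y := by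
  by_cases h0 : y 0 = 0
  · have h1 : y 1 ≠ 0 := fun h1 => hy (by ext i; fin_cases i <;> simp [h0, h1])
    refine ⟨q 1 / y 1, ?_⟩
    ext i
    fin_cases i
    · simpa [h0, h1] using h
    · simp [h1]
  · refine ⟨q 0 / y 0, ?_⟩
    ext i
    fin_cases i
    · simp [h0]
    · simp; field_simp; linear_combination h

theorem phi_smul_right (t : ℂ) (x y : Fin 2 → ℂ) : phi x (t • y) = phi (t ^ 2 • x) y := by
  ext i; fin_cases i <;> simp [phi] <;> ring

theorem smul_phi (a : ℂ) (x y : Fin 2 → ℂ) : a • phi x y = phi (a • x) y := by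
  ext i; fin_cases i <;> simp [phi] <;> ring

theorem eq_of_phi_add_phi_eq {x x' p p' y y' : Fin 2 → ℂ} (hy : y 0 * y' 1 - y 1 * y' 0 ≠ 0)
    (h : phi x y + phi x' y' = phi p y + phi p' y') : x = p := by
  have e := congrFun h
  have e0 := e 0
  have e1 := e 1
  have e2 := e 2
  have e3 := e 3
  have e4 := e 4
  have e5 := e 5
  simp [phi] at e0 e1 e2 e3 e4 e5
  have hy2 := pow_ne_zero 2 hy
  ext i
  fin_cases i
  · refine mul_left_cancel₀ hy2 ?_
    dsimp only [Fin.zero_eta, Fin.mk_one]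
    linear_combination y' 1 ^ 2 * e0 - 2 * y' 0 * y' 1 * e1 + y' 0 ^ 2 * e2
  · refine mul_left_cancel₀ hy2 ?_
    dsimp only [Fin.zero_eta, Fin.mk_one]
    linear_combination y' 1 ^ 2 * e3 - 2 * y' 0 * y' 1 * e4 + y' 0 ^ 2 * e5

theorem phi_eq_of_bracket_eq_zero {x y x' y' p q p' q' : Fin 2 → ℂ}
    (hy : y 0 * y' 1 - y 1 * y' 0 ≠ 0)
    (h : phi x y + phi x' y' = phi p q + phi p' q')
    (hq : y 0 * q 1 - y 1 * q 0 = 0) (hq' : y' 0 * q' 1 - y' 1 * q' 0 = 0) :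
    phi p q = phi x y := by
  obtain ⟨t, rfl⟩ := exists_eq_smul_of_bracket_eq_zero (by rintro rfl; simp at hy) hq
  obtain ⟨s, rfl⟩ := exists_eq_smul_of_bracket_eq_zero (by rintro rfl; simp at hy) hq'
  rw [phi_smul_right, phi_smul_right] at h
  rw [phi_smul_right, eq_of_phi_add_phi_eq hy h]

/-- Off the locus where `Mmat` drops rank, a decomposition as a sum of two points of the cone over
the scroll is unique up to order. -/
theorem phi_eq_or_eq_of_add_eq {x y x' y' p q p' q' : Fin 2 → ℂ} {v : Fin 6 → ℂ}
    (hv : (Mmat v).rank = 2) (h : v = phi x y + phi x' y') (h' : v = phi p q + phi p' q') :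
    phi p q = phi x y ∨ phi p q = phi x' y' := by
  have hm := Mmat_minor_ne_zero hv
  obtain ⟨a₀₁, a₀₂, a₁₂⟩ := minors_phi_add_phi x y x' y' h
  obtain ⟨b₀₁, b₀₂, b₁₂⟩ := minors_phi_add_phi p q p' q' h'
  have hne : (x 0 * x' 1 - x 1 * x' 0) * (y 0 * y' 1 - y 1 * y' 0) ≠ 0 := by
    intro h0
    rw [h0] at a₀₁ a₀₂ a₁₂
    exact hm (by simp [a₀₁, a₀₂, a₁₂])
  have hG : q 0 * q' 1 - q 1 * q' 0 ≠ 0 := by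
    intro h0
    rw [h0] at b₀₁ b₀₂ b₁₂
    exact hm (by simp [b₀₁, b₀₂, b₁₂])
  have hE := right_ne_zero_of_mul hne
  have hyq : (y 0 * q 1 - y 1 * q 0) * (y' 0 * q 1 - y' 1 * q 0) = 0 := by
    refine (mul_eq_zero.mp ?_).resolve_left hne
    linear_combination q 1 ^ 2 * (b₀₁ - a₀₁) - q 0 * q 1 * (b₀₂ - a₀₂) + q 0 ^ 2 * (b₁₂ - a₁₂)
  have hyq' : (y 0 * q' 1 - y 1 * q' 0) * (y' 0 * q' 1 - y' 1 * q' 0) = 0 := by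
    refine (mul_eq_zero.mp ?_).resolve_left hne
    linear_combination
      q' 1 ^ 2 * (b₀₁ - a₀₁) - q' 0 * q' 1 * (b₀₂ - a₀₂) + q' 0 ^ 2 * (b₁₂ - a₁₂)
  have key : ∀ z z' : Fin 2 → ℂ, z 0 * z' 1 - z 1 * z' 0 ≠ 0 → z 0 * q 1 - z 1 * q 0 = 0 →
      z 0 * q' 1 - z 1 * q' 0 ≠ 0 := by
    intro z z' hz hzq hzq'
    obtain ⟨t, rfl⟩ := exists_eq_smul_of_bracket_eq_zero (by rintro rfl; simp at hz) hzq
    obtain ⟨s, rfl⟩ := exists_eq_smul_of_bracket_eq_zero (by rintro rfl; simp at hz) hzq'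
    apply hG
    simp
    ring
  rcases mul_eq_zero.mp hyq with hq | hq
  · exact .inl (phi_eq_of_bracket_eq_zero hE (h.symm.trans h') hq
      ((mul_eq_zero.mp hyq').resolve_left (key y y' hE hq)))
  · have hE_swap : y' 0 * y 1 - y' 1 * y 0 ≠ 0 := fun h0 => hE (by linear_combination -h0)
    exact .inr (phi_eq_of_bracket_eq_zero hE_swap ((add_comm _ _).trans (h.symm.trans h')) hq
      ((mul_eq_zero.mp hyq').resolve_right (key y' y hE_swap hq)))

/-- A secant line through a point off `G³₃` is spanned by two points of the cone over the scroll
whose sum is the given point. -/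
theorem IsSecant.exists_eq_add {W : Submodule ℂ (Fin 6 → ℂ)} (hW : IsSecant W)
    {v : Fin 6 → ℂ} (hv : v ∈ W) (hr : (Mmat v).rank = 2) :
    ∃ x y x' y' : Fin 2 → ℂ, v = phi x y + phi x' y' ∧
      W = Submodule.span ℂ {phi x y, phi x' y'} := by
  obtain ⟨hdim, x, y, x', y', h, h', hli⟩ := hW
  have hspan : Submodule.span ℂ {phi x y, phi x' y'} = W := by
    refine Submodule.eq_of_le_of_finrank_eq (Submodule.span_le.mpr ?_) ?_
    · rintro _ (rfl | rfl)
      exacts [h, h']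
    · have hcard := finrank_span_eq_card hli
      rw [Matrix.range_cons_cons_empty] at hcard
      simpa [hdim] using hcard
  rw [← hspan, Submodule.mem_span_pair] at hv
  obtain ⟨a, b, rfl⟩ := hv
  have hm := Mmat_minor_ne_zero hr
  have hmin := minors_phi_add_phi (a • x) y (b • x') y' (by rw [← smul_phi, ← smul_phi])
  have ha : a ≠ 0 := by
    rintro rfl
    exact hm (by simpa using hmin)
  have hb : b ≠ 0 := by
    rintro rfl
    exact hm (by simpa using hmin)
  refine ⟨a • x, y, b • x', y', by rw [smul_phi, smul_phi], ?_⟩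
  rw [← hspan, ← smul_phi, ← smul_phi, Submodule.span_insert, Submodule.span_insert,
    Submodule.span_singleton_smul_eq ha.isUnit, Submodule.span_singleton_smul_eq hb.isUnit]

/-- Uniqueness of the secant of `R⁴` through a point off `G³₃`. -/
theorem unique_secant_off_G33 (v : Fin 6 → ℂ) (hv : (Mmat v).rank = 2)
    (W₁ W₂ : Submodule ℂ (Fin 6 → ℂ))
    (h₁ : IsSecant W₁) (h₂ : IsSecant W₂)
    (hv₁ : v ∈ W₁) (hv₂ : v ∈ W₂) : W₁ = W₂ := by
  obtain ⟨x, y, x', y', h, hW₁⟩ := h₁.exists_eq_add hv₁ hv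
  obtain ⟨p, q, p', q', h', hW₂⟩ := h₂.exists_eq_add hv₂ hv
  refine (Submodule.eq_of_le_of_finrank_eq ?_ (h₂.1.trans h₁.1.symm)).symm
  have mem : ∀ z : Fin 6 → ℂ, z = phi x y ∨ z = phi x' y' → z ∈ W₁ := fun z hz => by
    rw [hW₁]
    exact Submodule.subset_span hz
  rw [hW₂, Submodule.span_le]
  rintro _ (rfl | rfl)
  · exact mem _ (phi_eq_or_eq_of_add_eq hv h h')
  · exact mem _ (phi_eq_or_eq_of_add_eq hv h (h'.trans (add_comm _ _)))
end

section
/- For every nonzero v ∈ ℂ⁶ with rank M(v) ≤ 1 (i.e., [v] ∈ G³₃), the set of 2-dimensional ℂ-linear subspaces W ⊆ ℂ⁶ such that v ∈ W and W contains two linearly independent vectors of the form φ(x,y) is infinite. (Through each point of G³₃ there are infinitely many secant lines of R⁴.) -/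
theorem exists_outer_of_rank_Mmat_le_one {v : Fin 6 → ℂ} (hrk : (Mmat v).rank ≤ 1) :
    ∃ (a : Fin 2 → ℂ) (q : Fin 3 → ℂ),
      v = ![a 0 * q 0, a 0 * q 1, a 0 * q 2, a 1 * q 0, a 1 * q 1, a 1 * q 2] := by
  rw [Matrix.rank_eq_finrank_span_row, finrank_le_one_iff] at hrk
  obtain ⟨⟨q, _⟩, hq⟩ := hrk
  have key : ∀ i, ∃ c : ℂ, c • q = Mmat v i := fun i => by
    obtain ⟨c, hc⟩ := hq ⟨Mmat v i, Submodule.subset_span ⟨i, rfl⟩⟩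
    exact ⟨c, congrArg Subtype.val hc⟩
  choose a ha using key
  refine ⟨a, q, ?_⟩
  have h : ∀ i j, a i * q j = Mmat v i j := fun i j => congrFun (ha i) j
  ext k
  fin_cases k <;> simp [h, Mmat]

theorem linearIndependent_phi_conic {x : Fin 2 → ℂ} (hx : x ≠ 0) {r s t : ℂ}
    (hrs : r ≠ s) (hrt : r ≠ t) (hst : s ≠ t) :
    LinearIndependent ℂ ![phi x ![1, r], phi x ![1, s], phi x ![1, t]] := by
  rw [Fintype.linearIndependent_iff]
  intro g hg
  obtain ⟨i, hi⟩ := Function.ne_iff.mp hx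
  have e : ∃ c : ℂ, c ≠ 0 ∧ g 0 * c + g 1 * c + g 2 * c = 0 ∧
      g 0 * (c * r) + g 1 * (c * s) + g 2 * (c * t) = 0 ∧
      g 0 * (c * r ^ 2) + g 1 * (c * s ^ 2) + g 2 * (c * t ^ 2) = 0 := by
    refine ⟨x i, hi, ?_⟩
    have h := fun k => congrFun hg k
    fin_cases i
    · exact ⟨by simpa [Fin.sum_univ_three, phi] using h 0,
        by simpa [Fin.sum_univ_three, phi] using h 1,
        by simpa [Fin.sum_univ_three, phi] using h 2⟩
    · exact ⟨by simpa [Fin.sum_univ_three, phi] using h 3,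
        by simpa [Fin.sum_univ_three, phi] using h 4,
        by simpa [Fin.sum_univ_three, phi] using h 5⟩
  obtain ⟨c, hc, e0, e1, e2⟩ := e
  have h0 : g 0 * (c * (r - s) * (r - t)) = 0 := by
    linear_combination e2 - (s + t) * e1 + s * t * e0
  have h1 : g 1 * (c * (r - s) * (s - t)) = 0 := by
    linear_combination -e2 + (r + t) * e1 - r * t * e0
  have h2 : g 2 * (c * (r - t) * (s - t)) = 0 := by
    linear_combination e2 - (r + s) * e1 + r * s * e0
  simp only [mul_eq_zero, hc, sub_eq_zero, hrs, hrt, hst, or_false] at h0 h1 h2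
  intro k
  fin_cases k <;> assumption

theorem finite_setOf_phi_conic_mem {x : Fin 2 → ℂ} (hx : x ≠ 0)
    {W : Submodule ℂ (Fin 6 → ℂ)} (hW : Module.finrank ℂ W = 2) :
    {t : ℂ | phi x ![1, t] ∈ W}.Finite := by
  by_contra hinf
  obtain ⟨u, hu, hcard⟩ := Set.Infinite.exists_subset_card_eq hinf 3
  obtain ⟨r, s, t, hrs, hrt, hst, rfl⟩ := Finset.card_eq_three.mp hcard
  have hli := linearIndependent_phi_conic hx hrs hrt hst
  have hle : Submodule.span ℂ (Set.range ![phi x ![1, r], phi x ![1, s], phi x ![1, t]]) ≤ W := by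
    rw [Submodule.span_le]
    rintro _ ⟨k, rfl⟩
    fin_cases k
    · exact hu (by simp)
    · exact hu (by simp)
    · exact hu (by simp)
  have := Submodule.finrank_mono hle
  rw [finrank_span_eq_card hli, hW] at this
  simp at this

theorem linearIndependent_phi_pair {x y z : Fin 2 → ℂ} (hx : x ≠ 0)
    (hyz : y 0 * z 1 - y 1 * z 0 ≠ 0) : LinearIndependent ℂ ![phi x y, phi x z] := by
  rw [LinearIndependent.pair_iff]
  intro α β h
  obtain ⟨i, hi⟩ := Function.ne_iff.mp hx
  have e : ∃ c : ℂ, c ≠ 0 ∧ α * (c * y 0 ^ 2) + β * (c * z 0 ^ 2) = 0 ∧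
      α * (c * y 0 * y 1) + β * (c * z 0 * z 1) = 0 ∧
      α * (c * y 1 ^ 2) + β * (c * z 1 ^ 2) = 0 := by
    refine ⟨x i, hi, ?_⟩
    have h := fun k => congrFun h k
    fin_cases i
    · exact ⟨by simpa [phi] using h 0, by simpa [phi] using h 1, by simpa [phi] using h 2⟩
    · exact ⟨by simpa [phi] using h 3, by simpa [phi] using h 4, by simpa [phi] using h 5⟩
  obtain ⟨c, hc, e0, e1, e2⟩ := e
  have hα : α * (c * (y 0 * z 1 - y 1 * z 0) ^ 2) = 0 := by
    linear_combination z 1 ^ 2 * e0 - 2 * z 0 * z 1 * e1 + z 0 ^ 2 * e2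
  have hβ : β * (c * (y 0 * z 1 - y 1 * z 0) ^ 2) = 0 := by
    linear_combination y 1 ^ 2 * e0 - 2 * y 0 * y 1 * e1 + y 0 ^ 2 * e2
  simpa [hc, hyz] using And.intro hα hβ

theorem finite_setOf_quadratic_eq_zero {q : Fin 3 → ℂ} (hq : q ≠ 0) :
    {t : ℂ | q 2 - 2 * t * q 1 + t ^ 2 * q 0 = 0}.Finite := by
  open Polynomial in
  let p : ℂ[X] := C (q 0) * X ^ 2 + C (-2 * q 1) * X + C (q 2)
  have hp : p ≠ 0 := by
    intro h
    have h0 := congrArg (Polynomial.coeff · 2) h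
    have h1 := congrArg (Polynomial.coeff · 1) h
    have h2 := congrArg (Polynomial.coeff · 0) h
    apply hq
    ext k
    fin_cases k
    · simpa [p, Polynomial.coeff_X, Polynomial.coeff_C] using h0
    · simpa [p, Polynomial.coeff_X, Polynomial.coeff_C] using h1
    · simpa [p, Polynomial.coeff_X, Polynomial.coeff_C] using h2
  refine (Polynomial.finite_setOfPred_isRoot hp).subset fun t ht => ?_
  simp only [Set.mem_ofPred_eq, Polynomial.IsRoot.def, p, Polynomial.eval_add, Polynomial.eval_mul,
    Polynomial.eval_pow, Polynomial.eval_C, Polynomial.eval_X] at ht ⊢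
  linear_combination ht

/-- Through each point of `G³₃` there are infinitely many secant lines of `R⁴`. -/
theorem infinitely_many_secants_through_G33 (v : Fin 6 → ℂ) (hv : v ≠ 0)
    (hrk : (Mmat v).rank ≤ 1) :
    {W : Submodule ℂ (Fin 6 → ℂ) | IsSecant W ∧ v ∈ W}.Infinite := by
  obtain ⟨a, q, rfl⟩ := exists_outer_of_rank_Mmat_le_one hrk
  have ha : a ≠ 0 := by
    rintro rfl
    exact hv (by ext k; fin_cases k <;> simp)
  have hq : q ≠ 0 := by
    rintro rfl
    exact hv (by ext k; fin_cases k <;> simp)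
  intro hfin
  -- The chord of the conic `a × ℙ¹` through `q` and `(1, t)` meets the conic again at `z t`.
  let z : ℂ → Fin 2 → ℂ := fun t => ![q 1 - t * q 0, q 2 - t * q 1]
  have hcover : {t : ℂ | q 2 - 2 * t * q 1 + t ^ 2 * q 0 = 0}ᶜ ⊆
      ⋃ W ∈ {W : Submodule ℂ (Fin 6 → ℂ) | IsSecant W ∧
        ![a 0 * q 0, a 0 * q 1, a 0 * q 2, a 1 * q 0, a 1 * q 1, a 1 * q 2] ∈ W},
        {t : ℂ | phi a ![1, t] ∈ W} := by
    intro t ht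
    have hD : q 2 - 2 * t * q 1 + t ^ 2 * q 0 ≠ 0 := ht
    have hli : LinearIndependent ℂ ![phi a ![1, t], phi a (z t)] := by
      refine linearIndependent_phi_pair ha fun h => hD ?_
      simp only [z, Matrix.cons_val_zero, Matrix.cons_val_one] at h
      linear_combination h
    have hmem : ∀ k, ![phi a ![1, t], phi a (z t)] k ∈
        Submodule.span ℂ (Set.range ![phi a ![1, t], phi a (z t)]) :=
      fun k => Submodule.subset_span ⟨k, rfl⟩
    refine Set.mem_biUnion (x := Submodule.span ℂ (Set.range ![phi a ![1, t], phi a (z t)]))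
      ⟨⟨by simp [finrank_span_eq_card hli], a, _, a, _, hmem 0, hmem 1, hli⟩, ?_⟩ (hmem 0)
    rw [← Submodule.smul_mem_iff _ hD]
    convert Submodule.add_mem _ (Submodule.smul_mem _ (q 0 * q 2 - q 1 ^ 2) (hmem 0)) (hmem 1)
      using 1
    ext k
    fin_cases k <;> simp [phi, z] <;> ring
  refine (finite_setOf_quadratic_eq_zero hq).infinite_compl
    ((hfin.biUnion fun W hW => ?_).subset hcover)
  exact finite_setOf_phi_conic_mem ha hW.1.1
end

section
/- Let x, y, x', y' ∈ ℂ² be such that φ(x,y) and φ(x',y') are linearly independent, and suppose the 2-dimensional subspace W = span{φ(x,y), φ(x',y')} is also spanned by two vectors of the form a = (1, a₀₁, a₀₂, 0, a₁₁, a₁₂) and b = (0, b₀₁, b₀₂, 1, b₁₁, b₁₂). Then a₀₂ = a₀₁² + a₁₁b₀₁, a₁₂ = a₁₁(a₀₁ + b₁₁), b₀₂ = b₀₁(a₀₁ + b₁₁), and b₁₂ = a₁₁b₀₁ + b₁₁². (In the standard Grassmannian chart centered at a line of the ruling of R⁴, the variety M₄ of secant lines of R⁴ is the graph of a polynomial map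 ℂ⁴ → ℂ⁴; this is the key step in proving that M₄ is smooth at points of the orbit 1₁.) -/
/-- If `φ(x,y)` is nonzero and lies in the span of the two chart vectors, then it has coordinates
`x₀y₀²`, `x₁y₀²` there, and `x` is annihilated by the difference between the second
`2 × 2` block of the chart and the square of the first one. -/
theorem phi_mem_span_chart {x y : Fin 2 → ℂ} {a01 a02 a11 a12 b01 b02 b11 b12 : ℂ}
    (hne : phi x y ≠ 0)
    (hmem : phi x y ∈ Submodule.span ℂ
      ({![1, a01, a02, 0, a11, a12], ![0, b01, b02, 1, b11, b12]} : Set (Fin 6 → ℂ))) :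
    phi x y = (x 0 * y 0 ^ 2) • ![1, a01, a02, 0, a11, a12] +
        (x 1 * y 0 ^ 2) • ![0, b01, b02, 1, b11, b12] ∧
      (a02 - (a01 ^ 2 + a11 * b01)) * x 0 + (b02 - b01 * (a01 + b11)) * x 1 = 0 ∧
      (a12 - a11 * (a01 + b11)) * x 0 + (b12 - (a11 * b01 + b11 ^ 2)) * x 1 = 0 := by
  obtain ⟨p, q, hpq⟩ := Submodule.mem_span_pair.1 hmem
  have h0 : p = x 0 * y 0 ^ 2 := by simpa [phi] using congrFun hpq 0
  have h3 : q = x 1 * y 0 ^ 2 := by simpa [phi] using congrFun hpq 3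
  subst h0 h3
  have hy : y 0 ≠ 0 := by
    intro hy
    apply hne
    rw [← hpq]
    simp [hy]
  have h1 : x 0 * y 0 ^ 2 * a01 + x 1 * y 0 ^ 2 * b01 = x 0 * y 0 * y 1 := by
    simpa [phi] using congrFun hpq 1
  have h2 : x 0 * y 0 ^ 2 * a02 + x 1 * y 0 ^ 2 * b02 = x 0 * y 1 ^ 2 := by
    simpa [phi] using congrFun hpq 2
  have h4 : x 0 * y 0 ^ 2 * a11 + x 1 * y 0 ^ 2 * b11 = x 1 * y 0 * y 1 := by
    simpa [phi] using congrFun hpq 4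
  have h5 : x 0 * y 0 ^ 2 * a12 + x 1 * y 0 ^ 2 * b12 = x 1 * y 1 ^ 2 := by
    simpa [phi] using congrFun hpq 5
  have k1 : y 0 * (x 0 * a01 + x 1 * b01) = x 0 * y 1 :=
    mul_left_cancel₀ hy (by linear_combination h1)
  have k4 : y 0 * (x 0 * a11 + x 1 * b11) = x 1 * y 1 :=
    mul_left_cancel₀ hy (by linear_combination h4)
  refine ⟨hpq.symm, mul_left_cancel₀ (pow_ne_zero 2 hy) ?_,
    mul_left_cancel₀ (pow_ne_zero 2 hy) ?_⟩
  · linear_combination h2 - y 0 * a01 * k1 - y 0 * b01 * k4 - y 1 * k1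
  · linear_combination h5 - y 0 * a11 * k1 - y 0 * b11 * k4 - y 1 * k4

/-- A `2 × 2` system with nonvanishing determinant has only the zero solution. -/
theorem eq_zero_of_det_ne_zero {R : Type*} [CommRing R] [NoZeroDivisors R] {c d u v u' v' : R}
    (hdet : u * v' - v * u' ≠ 0) (h : c * u + d * v = 0) (h' : c * u' + d * v' = 0) :
    c = 0 ∧ d = 0 :=
  ⟨(mul_eq_zero.1 (by linear_combination v' * h - v * h' :
      (u * v' - v * u') * c = 0)).resolve_left hdet,
    (mul_eq_zero.1 (by linear_combination u * h' - u' * h :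
      (u * v' - v * u') * d = 0)).resolve_left hdet⟩

/-- Two linearly independent combinations `(u r) • a + (v r) • b` and `(u' r') • a + (v' r') • b`
have nonvanishing coefficient determinant `u v' - v u'`. -/
theorem det_ne_zero_of_linearIndependent {K V : Type*} [Field K] [AddCommGroup V] [Module K V]
    {a b w w' : V} {u v r u' v' r' : K} (hli : LinearIndependent K ![w, w'])
    (hw : w = (u * r) • a + (v * r) • b) (hw' : w' = (u' * r') • a + (v' * r') • b) :
    u * v' - v * u' ≠ 0 := by
  intro hdet
  have hne : w ≠ 0 := hli.ne_zero 0
  rw [LinearIndependent.pair_iff] at hli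
  have hu := (hli (u' * r') (-(u * r)) (by
    rw [hw, hw']
    linear_combination (norm := module) (-(r * r') * hdet) • b)).2
  have hv := (hli (v' * r') (-(v * r)) (by
    rw [hw, hw']
    linear_combination (norm := module) (r * r' * hdet) • a)).2
  rw [neg_eq_zero] at hu hv
  exact hne (by rw [hw, hu, hv, zero_smul, zero_smul, add_zero])

/-- In the standard Grassmannian chart centered at a line of the ruling of `R⁴`,
the variety `M₄` of secant lines of `R⁴` is the graph of a polynomial map `ℂ⁴ → ℂ⁴`:
if the span of two linearly independent vectors `φ(x,y)`, `φ(x',y')` is also spanned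
by `a = (1,a₀₁,a₀₂,0,a₁₁,a₁₂)` and `b = (0,b₀₁,b₀₂,1,b₁₁,b₁₂)`, then the coordinates
`a₀₂, a₁₂, b₀₂, b₁₂` are the stated polynomials in `a₀₁, a₁₁, b₀₁, b₁₁`. -/
theorem secants_graph_in_chart_1_1 (x y x' y' : Fin 2 → ℂ)
    (hli : LinearIndependent ℂ ![phi x y, phi x' y'])
    (a01 a02 a11 a12 b01 b02 b11 b12 : ℂ)
    (hspan : Submodule.span ℂ {phi x y, phi x' y'} =
      Submodule.span ℂ ({![1, a01, a02, 0, a11, a12], ![0, b01, b02, 1, b11, b12]} :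
        Set (Fin 6 → ℂ))) :
    a02 = a01^2 + a11 * b01 ∧ a12 = a11 * (a01 + b11) ∧
      b02 = b01 * (a01 + b11) ∧ b12 = a11 * b01 + b11^2 := by
  have hne : phi x y ≠ 0 := hli.ne_zero 0
  have hne' : phi x' y' ≠ 0 := hli.ne_zero 1
  obtain ⟨e, h1, h2⟩ := phi_mem_span_chart hne
    (hspan.le (Submodule.subset_span (Set.mem_insert _ _)))
  obtain ⟨e', h1', h2'⟩ := phi_mem_span_chart hne'
    (hspan.le (Submodule.subset_span (Set.mem_insert_of_mem _ rfl)))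
  have hdet : x 0 * x' 1 - x 1 * x' 0 ≠ 0 := det_ne_zero_of_linearIndependent hli e e'
  obtain ⟨ha02, hb02⟩ := eq_zero_of_det_ne_zero hdet h1 h1'
  obtain ⟨ha12, hb12⟩ := eq_zero_of_det_ne_zero hdet h2 h2'
  exact ⟨sub_eq_zero.1 ha02, sub_eq_zero.1 ha12, sub_eq_zero.1 hb02, sub_eq_zero.1 hb12⟩
end

section
/- Let x, y, x', y' ∈ ℂ² be such that φ(x,y) and φ(x',y') are linearly independent, and suppose the 2-dimensional subspace W = span{φ(x,y), φ(x',y')} is also spanned by two vectors of the form a = (1, 0, a₀₂, a₁₀, a₁₁, a₁₂) and b = (0, 1, b₀₂, b₁₀, b₁₁, b₁₂). Then a₁₁ = a₀₂b₁₀, b₁₁ = a₁₀ + b₀₂b₁₀, a₁₂ = a₀₂(a₁₀ + b₁₀b₀₂), and b₁₂ = a₁₀b₀₂ + b₁₀a₀₂ + b₁₀b₀₂². (In the standard Grassmannian chart centered at a line tangent to a conic of R⁴, the variety M₄ of secant lines of R⁴ is the graph of a polynomial map ℂ⁴ → ℂ⁴; this is the key step in proving that M₄ is smooth at points of the orbit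 2₂.) -/
/-- A point `φ(x, y)` of the affine cone over the scroll with `y₀ ≠ 0` which lies in the span of the
chart vectors satisfies the linear relations between its first two coordinates that cut out the
secant graph. -/
lemma phi_chart_relations {x y : Fin 2 → ℂ} {a02 a10 a11 a12 b02 b10 b11 b12 : ℂ}
    (hy : y 0 ≠ 0)
    (h : phi x y ∈ Submodule.span ℂ
      ({![1, 0, a02, a10, a11, a12], ![0, 1, b02, b10, b11, b12]} : Set (Fin 6 → ℂ))) :
    phi x y 0 * (a11 - a02 * b10) + phi x y 1 * (b11 - (a10 + b02 * b10)) = 0 ∧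
      phi x y 0 * (a12 - a02 * b11) + phi x y 1 * (b12 - (a11 + b02 * b11)) = 0 := by
  obtain ⟨s, t, hst⟩ := Submodule.mem_span_pair.mp h
  have h0 := congrFun hst 0
  have h1 := congrFun hst 1
  have h2 := congrFun hst 2
  have h3 := congrFun hst 3
  have h4 := congrFun hst 4
  have h5 := congrFun hst 5
  simp [phi] at h0 h1 h2 h3 h4 h5 ⊢
  subst h0 h1
  constructor <;> apply mul_left_cancel₀ hy
  · linear_combination y 0 * h4 - y 1 * h3 - y 0 * b10 * h2
  · linear_combination y 0 * h5 - y 1 * h4 - y 0 * b11 * h2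

/-- If two vectors span the same subspace as the chart vectors, their first two coordinates have
nonzero determinant. -/
lemma det_ne_zero_of_span_eq_chart {p q : Fin 6 → ℂ} {a02 a10 a11 a12 b02 b10 b11 b12 : ℂ}
    (h : Submodule.span ℂ {p, q} = Submodule.span ℂ
      ({![1, 0, a02, a10, a11, a12], ![0, 1, b02, b10, b11, b12]} : Set (Fin 6 → ℂ))) :
    p 0 * q 1 - p 1 * q 0 ≠ 0 := by
  have ha : ![1, 0, a02, a10, a11, a12] ∈ Submodule.span ℂ {p, q} :=
    h ▸ Submodule.subset_span (by simp)
  have hb : ![0, 1, b02, b10, b11, b12] ∈ Submodule.span ℂ {p, q} :=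
    h ▸ Submodule.subset_span (by simp)
  obtain ⟨s, t, hst⟩ := Submodule.mem_span_pair.mp ha
  obtain ⟨u, v, huv⟩ := Submodule.mem_span_pair.mp hb
  have a0 := congrFun hst 0
  have a1 := congrFun hst 1
  have b0 := congrFun huv 0
  have b1 := congrFun huv 1
  simp at a0 a1 b0 b1
  intro hD
  have key : (1 : ℂ) = 0 := by
    linear_combination (s * v - t * u) * hD - (u * p 1 + v * q 1) * a0 - b1 +
      (u * p 0 + v * q 0) * a1
  exact one_ne_zero key

lemma eq_zero_of_det_ne_zero_s3 {p₀ p₁ q₀ q₁ c d : ℂ} (hD : p₀ * q₁ - p₁ * q₀ ≠ 0)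
    (hp : p₀ * c + p₁ * d = 0) (hq : q₀ * c + q₁ * d = 0) : c = 0 ∧ d = 0 := by
  constructor <;> apply mul_left_cancel₀ hD
  · linear_combination q₁ * hp - p₁ * hq
  · linear_combination p₀ * hq - q₀ * hp

/-- In the standard Grassmannian chart centered at a line tangent to a conic of `R⁴`,
the variety `M₄` of secant lines of `R⁴` is the graph of a polynomial map `ℂ⁴ → ℂ⁴`:
if the span of two linearly independent vectors `φ(x,y)`, `φ(x',y')` is also spanned
by `a = (1,0,a₀₂,a₁₀,a₁₁,a₁₂)` and `b = (0,1,b₀₂,b₁₀,b₁₁,b₁₂)`, then the coordinates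
`a₁₁, b₁₁, a₁₂, b₁₂` are the stated polynomials in `a₀₂, a₁₀, b₀₂, b₁₀`. -/
theorem secants_graph_in_chart_2_2 (x y x' y' : Fin 2 → ℂ)
    (hli : LinearIndependent ℂ ![phi x y, phi x' y'])
    (a02 a10 a11 a12 b02 b10 b11 b12 : ℂ)
    (hspan : Submodule.span ℂ {phi x y, phi x' y'} =
      Submodule.span ℂ ({![1, 0, a02, a10, a11, a12], ![0, 1, b02, b10, b11, b12]} :
        Set (Fin 6 → ℂ))) :
    a11 = a02 * b10 ∧ b11 = a10 + b02 * b10 ∧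
      a12 = a02 * (a10 + b10 * b02) ∧ b12 = a10 * b02 + b10 * a02 + b10 * b02^2 := by
  have hD := det_ne_zero_of_span_eq_chart hspan
  have hy : y 0 ≠ 0 := fun h0 => hD (by simp [phi, h0])
  have hy' : y' 0 ≠ 0 := fun h0 => hD (by simp [phi, h0])
  obtain ⟨hp, hp'⟩ := phi_chart_relations (x := x) hy (hspan ▸ Submodule.subset_span (by simp))
  obtain ⟨hq, hq'⟩ := phi_chart_relations (x := x') hy' (hspan ▸ Submodule.subset_span (by simp))
  obtain ⟨h1, h2⟩ := eq_zero_of_det_ne_zero_s3 hD hp hq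
  obtain ⟨h3, h4⟩ := eq_zero_of_det_ne_zero_s3 hD hp' hq'
  refine ⟨?_, ?_, ?_, ?_⟩
  · linear_combination h1
  · linear_combination h2
  · linear_combination h3 + a02 * h2
  · linear_combination h4 + h1 + b02 * h2
end

section
/- Fix a nonzero y ∈ ℂ² and let W ⊆ ℂ⁶ be a linear subspace of dimension at most 3 that contains φ(x, y) for every x ∈ ℂ² (i.e., the plane P(W) ⊂ ℙ⁵ contains the line of the ruling of R⁴ corresponding to y). Suppose x₁, y₁, x₂, y₂ ∈ ℂ² are nonzero, neither y₁ nor y₂ is proportional to y, and φ(x₁,y₁), φ(x₂,y₂) ∈ W. Then φ(x₁,y₁) and φ(x₂,y₂) are proportional, i.e., they define the same point of ℙ⁵. (There is no plane in ℙ⁵ containing a line of R⁴ and two more distinct points of R⁴.) -/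
/-- Two plane vectors, the first nonzero, are proportional when their determinant vanishes. -/
lemma exists_eq_smul_of_det_eq_zero {K : Type*} [Field K] {y z : Fin 2 → K} (hy : y ≠ 0)
    (h : y 0 * z 1 - y 1 * z 0 = 0) : ∃ t : K, z = t • y := by
  by_cases h0 : y 0 = 0
  · have h1 : y 1 ≠ 0 := by
      intro h1
      exact hy (by ext i; fin_cases i <;> simp [h0, h1])
    refine ⟨z 1 / y 1, ?_⟩
    ext i
    fin_cases i
    · simp_all
    · simp [h1]
  · refine ⟨z 0 / y 0, ?_⟩
    ext i
    fin_cases i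
    · simp [h0]
    · simp only [Fin.mk_one, Pi.smul_apply, smul_eq_mul]
      field_simp
      linear_combination h

/-- A subspace of dimension at most `3` containing a line of the ruling and two more points of
the cone carries a nontrivial linear relation between them. -/
lemma exists_phi_relation {y x₁ y₁ x₂ y₂ : Fin 2 → ℂ} {W : Submodule ℂ (Fin 6 → ℂ)}
    (hW : Module.finrank ℂ W ≤ 3) (hline : ∀ x : Fin 2 → ℂ, phi x y ∈ W)
    (h₁ : phi x₁ y₁ ∈ W) (h₂ : phi x₂ y₂ ∈ W) :
    ∃ (x : Fin 2 → ℂ) (c d : ℂ), ¬ (x = 0 ∧ c = 0 ∧ d = 0) ∧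
      phi x y + c • phi x₁ y₁ + d • phi x₂ y₂ = 0 := by
  let f : Fin 4 → W :=
    ![⟨phi ![1, 0] y, hline _⟩, ⟨phi ![0, 1] y, hline _⟩, ⟨_, h₁⟩, ⟨_, h₂⟩]
  have hf : ¬ LinearIndependent ℂ f := by
    intro hf
    have := hf.fintype_card_le_finrank
    simp only [Fintype.card_fin] at this
    omega
  obtain ⟨g, hg, i, hi⟩ := Fintype.not_linearIndependent_iff.mp hf
  refine ⟨![g 0, g 1], g 2, g 3, ?_, ?_⟩
  · rintro ⟨hx, hc, hd⟩
    have h0 : g 0 = 0 := by simpa using congrFun hx 0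
    have h1 : g 1 = 0 := by simpa using congrFun hx 1
    fin_cases i <;> simp_all
  · have hsum := congrArg Subtype.val hg
    simp only [Fin.sum_univ_four, f] at hsum
    rw [← Submodule.coe_zero (p := W), ← hsum]
    ext j
    fin_cases j <;> simp [phi] <;> ring

/-- There is no plane in `ℙ⁵` containing a line of the ruling of `R⁴` and two more
distinct points of `R⁴`: if a subspace `W ⊆ ℂ⁶` of dimension at most `3` contains
`φ(x,y)` for every `x` (i.e. the plane `P(W)` contains the line of the ruling given
by `y`), and contains `φ(x₁,y₁)` and `φ(x₂,y₂)` with `y₁, y₂` not proportional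
to `y`, then `φ(x₁,y₁)` and `φ(x₂,y₂)` are proportional. -/
theorem no_plane_through_line_and_two_points (y : Fin 2 → ℂ) (hy : y ≠ 0)
    (W : Submodule ℂ (Fin 6 → ℂ)) (hW : Module.finrank ℂ W ≤ 3)
    (hline : ∀ x : Fin 2 → ℂ, phi x y ∈ W)
    (x₁ y₁ x₂ y₂ : Fin 2 → ℂ)
    (hx₁ : x₁ ≠ 0) (hy₁ : y₁ ≠ 0) (hx₂ : x₂ ≠ 0) (hy₂ : y₂ ≠ 0)
    (hy₁y : ∀ c : ℂ, y₁ ≠ c • y) (hy₂y : ∀ c : ℂ, y₂ ≠ c • y)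
    (h₁ : phi x₁ y₁ ∈ W) (h₂ : phi x₂ y₂ ∈ W) :
    ∃ c : ℂ, c ≠ 0 ∧ phi x₂ y₂ = c • phi x₁ y₁ := by
  obtain ⟨x, c, d, hne, hrel⟩ := exists_phi_relation hW hline h₁ h₂
  have hD₁ : y 0 * y₁ 1 - y 1 * y₁ 0 ≠ 0 := fun h =>
    (exists_eq_smul_of_det_eq_zero hy h).elim hy₁y
  have hD₂ : y 0 * y₂ 1 - y 1 * y₂ 0 ≠ 0 := fun h =>
    (exists_eq_smul_of_det_eq_zero hy h).elim hy₂y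
  have hcoord : ∀ i, x i * y 0 ^ 2 + c * (x₁ i * y₁ 0 ^ 2) + d * (x₂ i * y₂ 0 ^ 2) = 0 ∧
      x i * y 0 * y 1 + c * (x₁ i * y₁ 0 * y₁ 1) + d * (x₂ i * y₂ 0 * y₂ 1) = 0 ∧
      x i * y 1 ^ 2 + c * (x₁ i * y₁ 1 ^ 2) + d * (x₂ i * y₂ 1 ^ 2) = 0 := by
    have e := congrFun hrel
    intro i
    fin_cases i
    · exact ⟨by simpa [phi] using e 0, by simpa [phi] using e 1, by simpa [phi] using e 2⟩
    · exact ⟨by simpa [phi] using e 3, by simpa [phi] using e 4, by simpa [phi] using e 5⟩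
  have hx : ∀ i, c * (y 0 * y₁ 1 - y 1 * y₁ 0) ^ 2 * x₁ i +
      d * (y 0 * y₂ 1 - y 1 * y₂ 0) ^ 2 * x₂ i = 0 := by
    intro i
    obtain ⟨p, q, r⟩ := hcoord i
    linear_combination y 1 ^ 2 * p - 2 * y 0 * y 1 * q + y 0 ^ 2 * r
  have hdet : ∀ i, d * (y 0 * y₂ 1 - y 1 * y₂ 0) * (y₁ 0 * y₂ 1 - y₁ 1 * y₂ 0) * x₂ i = 0 := by
    intro i
    obtain ⟨p, q, r⟩ := hcoord i
    linear_combination y 1 * y₁ 1 * p - (y 0 * y₁ 1 + y 1 * y₁ 0) * q + y 0 * y₁ 0 * r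
  obtain ⟨i₁, hi₁⟩ := Function.ne_iff.mp hx₁
  obtain ⟨i₂, hi₂⟩ := Function.ne_iff.mp hx₂
  obtain ⟨k, hk⟩ := Function.ne_iff.mp hy
  simp only [Pi.zero_apply] at hi₁ hi₂ hk
  have hd : d ≠ 0 := by
    rintro rfl
    have hc : c = 0 := by simpa [hD₁, hi₁] using hx i₁
    refine hne ⟨?_, hc, rfl⟩
    ext i
    obtain ⟨p, -, r⟩ := hcoord i
    fin_cases k
    · simpa [hc, show y 0 ≠ 0 from hk] using p
    · simpa [hc, show y 1 ≠ 0 from hk] using r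
  have hc : c ≠ 0 := by
    rintro rfl
    simpa [hd, hD₂, hi₂] using hx i₂
  obtain ⟨t, rfl⟩ := exists_eq_smul_of_det_eq_zero (z := y₂) hy₁
    (by simpa [hd, hD₂, hi₂] using hdet i₂)
  have ht : t ≠ 0 := by
    rintro rfl
    simp at hy₂
  have hx₂eq : ∀ i, t ^ 2 * x₂ i = -(c / d) * x₁ i := by
    intro i
    have h := hx i
    simp only [Pi.smul_apply, smul_eq_mul] at h
    have h' : (y 0 * y₁ 1 - y 1 * y₁ 0) ^ 2 * (c * x₁ i + d * t ^ 2 * x₂ i) = 0 := by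
      linear_combination h
    have h'' := (mul_eq_zero.mp h').resolve_left (pow_ne_zero 2 hD₁)
    field_simp
    linear_combination h''
  refine ⟨-(c / d), neg_ne_zero.mpr (div_ne_zero hc hd), ?_⟩
  have e0 := hx₂eq 0
  have e1 := hx₂eq 1
  ext j
  fin_cases j <;> simp only [phi, Pi.smul_apply, smul_eq_mul] <;> simp
  · linear_combination y₁ 0 ^ 2 * e0
  · linear_combination y₁ 0 * y₁ 1 * e0
  · linear_combination y₁ 1 ^ 2 * e0
  · linear_combination y₁ 0 ^ 2 * e1
  · linear_combination y₁ 0 * y₁ 1 * e1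
  · linear_combination y₁ 1 ^ 2 * e1
end

section
/- For nonzero x = (x₀,x₁), y = (y₀,y₁) ∈ ℂ², the vector φ(x,y) lies in the linear span of (1,0,0,0,0,0) and (0,0,0,0,0,1) if and only if (x₁ = 0 and y₁ = 0) or (x₀ = 0 and y₀ = 0). Consequently the line {z₀₁ = z₀₂ = z₁₀ = z₁₁ = 0} ⊂ ℙ⁵ meets R⁴ exactly in the two points [1,0,0,0,0,0] and [0,0,0,0,0,1], the images of ([1,0],[1,0]) and ([0,1],[0,1]). (This line is a secant meeting R⁴ transversally in two points, used to show that the secant map (ℙ¹×ℙ¹)² ⇢ M₄ is generically finite, so dim M₄ = 4.) -/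
/-- The line `{z₀₁ = z₀₂ = z₁₀ = z₁₁ = 0} ⊂ ℙ⁵`, i.e. the projectivization of the
span of `(1,0,0,0,0,0)` and `(0,0,0,0,0,1)`, meets `R⁴` exactly in the two points
`[1,0,0,0,0,0]` and `[0,0,0,0,0,1]`, the images of `([1,0],[1,0])` and
`([0,1],[0,1])`: for nonzero `x, y`, the vector `φ(x,y)` lies in that span if and
only if (`x₁ = 0` and `y₁ = 0`) or (`x₀ = 0` and `y₀ = 0`). -/
theorem secant_line_meets_scroll_in_two_points (x y : Fin 2 → ℂ)
    (hx : x ≠ 0) (hy : y ≠ 0) :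
    phi x y ∈ Submodule.span ℂ
        ({![1, 0, 0, 0, 0, 0], ![0, 0, 0, 0, 0, 1]} : Set (Fin 6 → ℂ)) ↔
      (x 1 = 0 ∧ y 1 = 0) ∨ (x 0 = 0 ∧ y 0 = 0) := by
  rw [Submodule.mem_span_pair]
  constructor
  · rintro ⟨a, b, h⟩
    have h₂ : x 0 * (y 1) ^ 2 = 0 := by
      simpa [phi, eq_comm] using congrFun h 2
    have h₃ : x 1 * (y 0) ^ 2 = 0 := by
      simpa [phi, eq_comm] using congrFun h 3
    have hx' : ¬(x 0 = 0 ∧ x 1 = 0) := fun ⟨h0, h1⟩ =>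
      hx (funext (Fin.forall_fin_two.2 ⟨h0, h1⟩))
    have hy' : ¬(y 0 = 0 ∧ y 1 = 0) := fun ⟨h0, h1⟩ =>
      hy (funext (Fin.forall_fin_two.2 ⟨h0, h1⟩))
    rw [mul_eq_zero, sq_eq_zero_iff] at h₂ h₃
    tauto
  · rintro (⟨h0, h1⟩ | ⟨h0, h1⟩) <;>
    · refine ⟨x 0 * (y 0) ^ 2, x 1 * (y 1) ^ 2, ?_⟩
      ext i
      fin_cases i <;> simp [phi, h0, h1]
end
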